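/- The stack of the first state of a push-monotonic path of abstract transitions is a suffix of the stack of every other state in the path. -/

import Mathlib

set_option autoImplicit true
set_option maxHeartbeats 1000000

namespace CFA2

/-! ## Syntax of Partitioned CPS -/

abbrev UVar := ℕ
abbrev CVar := ℕ
abbrev Lab := ℕ
abbrev Var := UVar ⊕ CVar

mutual
  inductive ULam : Type
    | mk (l : Lab) (u : UVar) (k : CVar) (body : Call)
  inductive CLam : Type
    | mk (g : Lab) (u : UVar) (body : Call)
  inductive UExp : Type
    | lam (f : ULam)
    | var (v : UVar)
  inductive CExp : Type
    | lam (f : CLam)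
    | var (k : CVar)
  inductive Call : Type
    | u (l : Lab) (f : UExp) (e : UExp) (q : CExp)
    | c (g : Lab) (q : CExp) (e : UExp)
end

def Call.lab : Call → Lab
  | .u l _ _ _ => l
  | .c g _ _ => g

-- Bound variables of a term.
mutual
  def ULam.bv : ULam → Set Var
    | .mk _ u k body => insert (Sum.inl u) (insert (Sum.inr k) (Call.bv body))
  def CLam.bv : CLam → Set Var
    | .mk _ u body => insert (Sum.inl u) (Call.bv body)
  def UExp.bv : UExp → Set Var
    | .lam f => ULam.bv f
    | .var _ => ∅
  def CExp.bv : CExp → Set Var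
    | .lam f => CLam.bv f
    | .var _ => ∅
  def Call.bv : Call → Set Var
    | .u _ f e q => UExp.bv f ∪ UExp.bv e ∪ CExp.bv q
    | .c _ q e => CExp.bv q ∪ UExp.bv e
end

-- The list of all binding occurrences of variables.
mutual
  def ULam.binders : ULam → List Var
    | .mk _ u k body => Sum.inl u :: Sum.inr k :: Call.binders body
  def CLam.binders : CLam → List Var
    | .mk _ u body => Sum.inl u :: Call.binders body
  def UExp.binders : UExp → List Var
    | .lam f => ULam.binders f
    | .var _ => []
  def CExp.binders : CExp → List Var
    | .lam f => CLam.binders f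
    | .var _ => []
  def Call.binders : Call → List Var
    | .u _ f e q => UExp.binders f ++ UExp.binders e ++ CExp.binders q
    | .c _ q e => CExp.binders q ++ UExp.binders e
end

/-- A program is alphatized: all variables have distinct names. -/
def Alphatized (pr : ULam) : Prop := (ULam.binders pr).Nodup

/-! ## Label groups, LV, LL, stack/heap references -/

-- Labels of a term that belong to the group of the enclosing user lambda
-- (we do not descend into nested user lambdas).
mutual
  def ULam.groupLabs : ULam → Set Lab
    | .mk l _ _ body => insert l (Call.topLabs body)
  def CLam.topLabs : CLam → Set Lab
    | .mk g _ body => insert g (Call.topLabs body)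
  def UExp.topLabs : UExp → Set Lab
    | .lam _ => ∅
    | .var _ => ∅
  def CExp.topLabs : CExp → Set Lab
    | .lam f => CLam.topLabs f
    | .var _ => ∅
  def Call.topLabs : Call → Set Lab
    | .u l f e q => insert l (UExp.topLabs f ∪ UExp.topLabs e ∪ CExp.topLabs q)
    | .c g q e => insert g (CExp.topLabs q ∪ UExp.topLabs e)
end

-- Variables bound by the lambdas whose labels belong to the group of the
-- enclosing user lambda.
mutual
  def ULam.groupVars : ULam → Set Var
    | .mk _ u k body => insert (Sum.inl u) (insert (Sum.inr k) (Call.topVars body))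
  def CLam.topVars : CLam → Set Var
    | .mk _ u body => insert (Sum.inl u) (Call.topVars body)
  def UExp.topVars : UExp → Set Var
    | .lam _ => ∅
    | .var _ => ∅
  def CExp.topVars : CExp → Set Var
    | .lam f => CLam.topVars f
    | .var _ => ∅
  def Call.topVars : Call → Set Var
    | .u _ f e q => UExp.topVars f ∪ UExp.topVars e ∪ CExp.topVars q
    | .c _ q e => CExp.topVars q ∪ UExp.topVars e
end

-- User lambdas occurring as subterms.
mutual
  def ULam.subULams : ULam → Set ULam
    | .mk l u k body => insert (.mk l u k body) (Call.subULams body)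
  def CLam.subULams : CLam → Set ULam
    | .mk _ _ body => Call.subULams body
  def UExp.subULams : UExp → Set ULam
    | .lam f => ULam.subULams f
    | .var _ => ∅
  def CExp.subULams : CExp → Set ULam
    | .lam f => CLam.subULams f
    | .var _ => ∅
  def Call.subULams : Call → Set ULam
    | .u _ f e q => UExp.subULams f ∪ UExp.subULams e ∪ CExp.subULams q
    | .c _ q e => CExp.subULams q ∪ UExp.subULams e
end

-- Continuation lambdas occurring as subterms.
mutual
  def ULam.subCLams : ULam → Set CLam
    | .mk _ _ _ body => Call.subCLams body
  def CLam.subCLams : CLam → Set CLam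
    | .mk g u body => insert (.mk g u body) (Call.subCLams body)
  def UExp.subCLams : UExp → Set CLam
    | .lam f => ULam.subCLams f
    | .var _ => ∅
  def CExp.subCLams : CExp → Set CLam
    | .lam f => CLam.subCLams f
    | .var _ => ∅
  def Call.subCLams : Call → Set CLam
    | .u _ f e q => UExp.subCLams f ∪ UExp.subCLams e ∪ CExp.subCLams q
    | .c _ q e => CExp.subCLams q ∪ UExp.subCLams e
end

-- Call sites occurring as subterms.
mutual
  def ULam.subCalls : ULam → Set Call
    | .mk _ _ _ body => Call.subCalls body
  def CLam.subCalls : CLam → Set Call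
    | .mk _ _ body => Call.subCalls body
  def UExp.subCalls : UExp → Set Call
    | .lam f => ULam.subCalls f
    | .var _ => ∅
  def CExp.subCalls : CExp → Set Call
    | .lam f => CLam.subCalls f
    | .var _ => ∅
  def Call.subCalls : Call → Set Call
    | .u l f e q => insert (.u l f e q) (UExp.subCalls f ∪ UExp.subCalls e ∪ CExp.subCalls q)
    | .c g q e => insert (.c g q e) (CExp.subCalls q ∪ UExp.subCalls e)
end

/-- `LV pr ψ`: the variables bound by the lambdas whose labels lie in the same
group as label `ψ` (labels grouped by innermost enclosing user lambda). -/
def LV (pr : ULam) (ψ : Lab) : Set Var :=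
  {v | ∃ ul ∈ ULam.subULams pr, ψ ∈ ULam.groupLabs ul ∧ v ∈ ULam.groupVars ul}

/-- `LL pr ψ`: the labels in the same group as `ψ`. -/
def LL (pr : ULam) (ψ : Lab) : Set Lab :=
  {ψ' | ∃ ul ∈ ULam.subULams pr, ψ ∈ ULam.groupLabs ul ∧ ψ' ∈ ULam.groupLabs ul}

-- Variables referenced (as immediate operands) at a call site.
def UExp.refVars : UExp → Set Var
  | .var v => {Sum.inl v}
  | .lam _ => ∅
def CExp.refVars : CExp → Set Var
  | .var k => {Sum.inr k}
  | .lam _ => ∅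
def Call.refVars : Call → Set Var
  | .u _ f e q => UExp.refVars f ∪ UExp.refVars e ∪ CExp.refVars q
  | .c _ q e => CExp.refVars q ∪ UExp.refVars e

/-- A heap variable: a user variable some of whose references are heap references. -/
def HVar (pr : ULam) (u : UVar) : Prop :=
  ∃ call ∈ ULam.subCalls pr, Sum.inl u ∈ Call.refVars call ∧ Sum.inl u ∉ LV pr (Call.lab call)

/-! ## Concrete semantics (Fig. 2) -/

abbrev Time := List Lab
abbrev BEnv := Var → Option Time

structure UClos where
  lam : ULam
  env : BEnv

inductive CClos : Type
  | clo (lam : CLam) (env : BEnv)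
  | halt

abbrev Clos := UClos ⊕ CClos
abbrev VEnv := Var → Time → Option Clos

def updB (β : BEnv) (v : Var) (t : Time) : BEnv :=
  fun x => if x = v then some t else β x

def updVE (ve : VEnv) (v : Var) (t : Time) (cl : Clos) : VEnv :=
  fun x s => if x = v ∧ s = t then some cl else ve x s

def emptyBE : BEnv := fun _ => none
def emptyVE : VEnv := fun _ _ => none

/-- Concrete evaluation of user expressions (the function `A` of Fig. 2). -/
inductive EvUC (β : BEnv) (ve : VEnv) : UExp → UClos → Prop
  | lam (f : ULam) : EvUC β ve (.lam f) ⟨f, β⟩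
  | var (v : UVar) (t : Time) (cl : UClos) :
      β (Sum.inl v) = some t → ve (Sum.inl v) t = some (.inl cl) →
      EvUC β ve (.var v) cl

/-- Concrete evaluation of continuation expressions. -/
inductive EvCC (β : BEnv) (ve : VEnv) : CExp → CClos → Prop
  | lam (f : CLam) : EvCC β ve (.lam f) (.clo f β)
  | var (k : CVar) (t : Time) (cl : CClos) :
      β (Sum.inr k) = some t → ve (Sum.inr k) t = some (.inr cl) →
      EvCC β ve (.var k) cl

/-- Concrete states. -/
inductive CState : Type
  | eval (call : Call) (β : BEnv) (ve : VEnv) (t : Time)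
  | applyU (proc : UClos) (d : UClos) (c : CClos) (ve : VEnv) (t : Time)
  | applyC (proc : CClos) (d : UClos) (ve : VEnv) (t : Time)

def veOf : CState → VEnv
  | .eval _ _ ve _ => ve
  | .applyU _ _ _ ve _ => ve
  | .applyC _ _ ve _ => ve

/-- The concrete transition relation (Fig. 2). -/
inductive CStep : CState → CState → Prop
  | uea : EvUC β ve f proc → EvUC β ve e d → EvCC β ve q c →
      CStep (.eval (.u l f e q) β ve t) (.applyU proc d c ve (l :: t))
  | uae : CStep (.applyU ⟨.mk l u k body, β⟩ d c ve t)
      (.eval body (updB (updB β (Sum.inl u) t) (Sum.inr k) t)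
        (updVE (updVE ve (Sum.inl u) t (.inl d)) (Sum.inr k) t (.inr c)) t)
  | cea : EvCC β ve q proc → EvUC β ve e d →
      CStep (.eval (.c g q e) β ve t) (.applyC proc d ve (g :: t))
  | cae : CStep (.applyC (.clo (.mk g u body) β) d ve t)
      (.eval body (updB β (Sum.inl u) t) (updVE ve (Sum.inl u) t (.inl d)) t)

/-- Initial concrete state of program `pr` on input `inp`. -/
def initC (pr inp : ULam) : CState :=
  .applyU ⟨pr, emptyBE⟩ ⟨inp, emptyBE⟩ .halt emptyVE []

/-- Domain of a binding environment. -/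
def domB (β : BEnv) : Set Var := {v | β v ≠ none}

/-! ## Abstract semantics (Fig. 4) -/

/-- Abstract user values: sets of user lambdas. -/
abbrev D := Set ULam

/-- Abstract continuations: a continuation lambda or halt. -/
inductive CAbs : Type
  | clam (f : CLam)
  | halt

/-- A frame maps user variables to abstract user values and continuation
variables to abstract continuations. -/
structure Frame where
  u : UVar → Option D
  k : CVar → Option CAbs

abbrev Stack := List Frame
abbrev Heap := UVar → Option D

def Frame.updU (tf : Frame) (v : UVar) (d : D) : Frame :=
  ⟨fun x => if x = v then some d else tf.u x, tf.k⟩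

def mkFrame (u : UVar) (d : D) (k : CVar) (c : CAbs) : Frame :=
  ⟨fun x => if x = u then some d else none, fun x => if x = k then some c else none⟩

/-- Heap join `h ⊔ [v ↦ d]`. -/
def hjoin (h : Heap) (v : UVar) (d : D) : Heap :=
  fun x => if x = v then some (d ∪ (h v).getD ∅) else h x

/-- Abstract states. -/
inductive AState : Type
  | eval (call : Call) (st : Stack) (h : Heap)
  | applyU (f : ULam) (d : D) (c : CAbs) (st : Stack) (h : Heap)
  | applyC (c : CAbs) (d : D) (st : Stack) (h : Heap)

instance : Inhabited AState := ⟨.applyC .halt ∅ [] (fun _ => none)⟩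

def stackOf : AState → Stack
  | .eval _ st _ => st
  | .applyU _ _ _ st _ => st
  | .applyC _ _ st _ => st

def setStack : AState → Stack → AState
  | .eval c _ h, st => .eval c st h
  | .applyU f d cc _ h, st => .applyU f d cc st h
  | .applyC cc d _ h, st => .applyC cc d st h

/-- Abstract evaluation of a user expression at call site `ψ`:
lambdas evaluate to singletons, stack references are looked up in the top
frame and heap references in the heap. -/
inductive AEvalU (pr : ULam) : UExp → Lab → Stack → Heap → D → Prop
  | lam (f : ULam) (ψ : Lab) (st : Stack) (h : Heap) :
      AEvalU pr (.lam f) ψ st h {f}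
  | stk (v : UVar) (ψ : Lab) (tf : Frame) (st : Stack) (h : Heap) (d : D) :
      Sum.inl v ∈ LV pr ψ → tf.u v = some d →
      AEvalU pr (.var v) ψ (tf :: st) h d
  | hp (v : UVar) (ψ : Lab) (st : Stack) (h : Heap) (d : D) :
      Sum.inl v ∉ LV pr ψ → h v = some d →
      AEvalU pr (.var v) ψ st h d

/-- The abstract transition relation of CFA2 (Fig. 4). -/
inductive AStep (pr : ULam) : AState → AState → Prop
  | uea_tail :
      AEvalU pr f l (tf :: st) h df → ulam ∈ df →
      AEvalU pr e l (tf :: st) h d →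
      tf.k kv = some c →
      AStep pr (.eval (.u l f e (.var kv)) (tf :: st) h) (.applyU ulam d c st h)
  | uea_flam :
      AEvalU pr e l st h d →
      AStep pr (.eval (.u l (.lam ulam) e (.lam cl)) st h)
               (.applyU ulam d (.clam cl) st h)
  | uea_fheap :
      Sum.inl fv ∉ LV pr l → h fv = some df → ulam ∈ df →
      AEvalU pr e l st h d →
      AStep pr (.eval (.u l (.var fv) e (.lam cl)) st h)
               (.applyU ulam d (.clam cl) st h)
  | uea_fstk :
      Sum.inl fv ∈ LV pr l → tf.u fv = some df → ulam ∈ df →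
      AEvalU pr e l (tf :: st) h d →
      AStep pr (.eval (.u l (.var fv) e (.lam cl)) (tf :: st) h)
               (.applyU ulam d (.clam cl) (Frame.updU tf fv {ulam} :: st) h)
  | uae_h :
      HVar pr u →
      AStep pr (.applyU (.mk l u k body) d c st h)
               (.eval body (mkFrame u d k c :: st) (hjoin h u d))
  | uae_s :
      ¬ HVar pr u →
      AStep pr (.applyU (.mk l u k body) d c st h)
               (.eval body (mkFrame u d k c :: st) h)
  | cea_var :
      tf.k kv = some c → AEvalU pr e g (tf :: st) h d →
      AStep pr (.eval (.c g (.var kv) e) (tf :: st) h) (.applyC c d st h)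
  | cea_lam :
      AEvalU pr e g st h d →
      AStep pr (.eval (.c g (.lam cl) e) st h) (.applyC (.clam cl) d st h)
  | cae_h :
      HVar pr u →
      AStep pr (.applyC (.clam (.mk g u body)) d (tf :: st) h)
               (.eval body (Frame.updU tf u d :: st) (hjoin h u d))
  | cae_s :
      ¬ HVar pr u →
      AStep pr (.applyC (.clam (.mk g u body)) d (tf :: st) h)
               (.eval body (Frame.updU tf u d :: st) h)

/-! ### Classification of abstract states -/

def IsEntry : AState → Prop
  | .applyU _ _ _ _ _ => True
  | _ => False
def IsExitCEval : AState → Prop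
  | .eval (.c _ (.var _) _) _ _ => True
  | _ => False
def IsTailCall : AState → Prop
  | .eval (.u _ _ _ (.var _)) _ _ => True
  | _ => False
def IsCall : AState → Prop
  | .eval (.u _ _ _ (.lam _)) _ _ => True
  | _ => False
def IsFinal : AState → Prop
  | .applyC .halt _ [] _ => True
  | _ => False

/-- Domain of a frame. -/
def domFrame (tf : Frame) : Set Var :=
  {v | ∃ u, v = Sum.inl u ∧ tf.u u ≠ none} ∪ {v | ∃ k, v = Sum.inr k ∧ tf.k k ≠ none}

/-! ### The order ⊑ on abstract states (Fig. 5) -/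

def FrameLE (f1 f2 : Frame) : Prop :=
  (∀ v d, f1.u v = some d → ∃ d', f2.u v = some d' ∧ d ⊆ d') ∧
  (∀ kv c, f1.k kv = some c → f2.k kv = some c)

def StackLE : Stack → Stack → Prop
  | [], [] => True
  | f1 :: s1, f2 :: s2 => FrameLE f1 f2 ∧ StackLE s1 s2
  | _, _ => False

def HeapLE (h1 h2 : Heap) : Prop :=
  ∀ v d, h1 v = some d → ∃ d', h2 v = some d' ∧ d ⊆ d'

def AStateLE : AState → AState → Prop
  | .eval c1 s1 h1, .eval c2 s2 h2 => c1 = c2 ∧ StackLE s1 s2 ∧ HeapLE h1 h2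
  | .applyU f1 d1 c1 s1 h1, .applyU f2 d2 c2 s2 h2 =>
      f1 = f2 ∧ d1 ⊆ d2 ∧ c1 = c2 ∧ StackLE s1 s2 ∧ HeapLE h1 h2
  | .applyC c1 d1 s1 h1, .applyC c2 d2 s2 h2 =>
      c1 = c2 ∧ d1 ⊆ d2 ∧ StackLE s1 s2 ∧ HeapLE h1 h2
  | _, _ => False

/-! ## Abstraction map |·|_ca from concrete to abstract states (Fig. 6) -/

def absU (cl : UClos) : D := {cl.lam}

def absC : CClos → CAbs
  | .clo f _ => .clam f
  | .halt => .halt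

open Classical in
/-- Abstraction of a variable environment: keep only heap variables, joining
over all times. -/
noncomputable def absVE (pr : ULam) (ve : VEnv) : Heap := fun v =>
  if HVar pr v then
    some {ul | ∃ t β', ve (Sum.inl v) t = some (.inl ⟨ul, β'⟩)}
  else none

open Classical in
/-- The user-variable part of the frame built by `toStack` for the variable
set `vs`: each user variable of `vs` in the domain of `β` is mapped to the
abstraction of its concrete value. -/
noncomputable def absEntryU (vs : Set Var) (β : BEnv) (ve : VEnv) : UVar → Option D :=
  fun v =>
    if Sum.inl v ∈ vs then
      (β (Sum.inl v)).bind fun t =>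
        (ve (Sum.inl v) t).bind fun cl =>
          match cl with
          | .inl ucl => some {ucl.lam}
          | .inr _ => none
    else none

/-- `ToStack pr ve vs β st`: `st` is the stack reconstructed from `β` and `ve`
for the variable set `vs` (the relation `toStack` of Fig. 6). -/
inductive ToStack (pr : ULam) (ve : VEnv) : Set Var → BEnv → Stack → Prop
  | halt (vs : Set Var) (β : BEnv) (kv : CVar) (t : Time) :
      Sum.inr kv ∈ vs →
      β (Sum.inr kv) = some t →
      ve (Sum.inr kv) t = some (.inr .halt) →
      ToStack pr ve vs β
        [⟨absEntryU vs β ve, fun x => if x = kv then some .halt else none⟩]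
  | cons (vs : Set Var) (β β' : BEnv) (kv : CVar) (t : Time) (g : Lab)
      (u : UVar) (body : Call) (st : Stack) :
      Sum.inr kv ∈ vs →
      β (Sum.inr kv) = some t →
      ve (Sum.inr kv) t = some (.inr (.clo (.mk g u body) β')) →
      ToStack pr ve (LV pr g) β' st →
      ToStack pr ve vs β
        (⟨absEntryU vs β ve,
          fun x => if x = kv then some (.clam (.mk g u body)) else none⟩ :: st)

/-- `CA pr ς ς̂`: `ς̂` is the abstraction `|ς|_ca` of the concrete state `ς`. -/
inductive CA (pr : ULam) : CState → AState → Prop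
  | eval (call : Call) (β : BEnv) (ve : VEnv) (t : Time) (st : Stack) :
      ToStack pr ve (LV pr (Call.lab call)) β st →
      CA pr (.eval call β ve t) (.eval call st (absVE pr ve))
  | applyU_halt (f : ULam) (β : BEnv) (d : UClos) (ve : VEnv) (t : Time) :
      CA pr (.applyU ⟨f, β⟩ d .halt ve t)
            (.applyU f (absU d) .halt [] (absVE pr ve))
  | applyU_clo (f : ULam) (β β' : BEnv) (d : UClos) (g : Lab) (u : UVar)
      (body : Call) (ve : VEnv) (t : Time) (st : Stack) :
      ToStack pr ve (LV pr g) β' st →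
      CA pr (.applyU ⟨f, β⟩ d (.clo (.mk g u body) β') ve t)
            (.applyU f (absU d) (.clam (.mk g u body)) st (absVE pr ve))
  | applyC_halt (d : UClos) (ve : VEnv) (t : Time) :
      CA pr (.applyC .halt d ve t) (.applyC .halt (absU d) [] (absVE pr ve))
  | applyC_clo (g : Lab) (u : UVar) (body : Call) (β : BEnv) (d : UClos)
      (ve : VEnv) (t : Time) (st : Stack) :
      ToStack pr ve (LV pr g) β st →
      CA pr (.applyC (.clo (.mk g u body) β) d ve t)
            (.applyC (.clam (.mk g u body)) (absU d) st (absVE pr ve))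

/-! ## Paths and push monotonicity -/

/-- `PushMono ste p`: every transition in `p` whose source has stack exactly
`ste` only pushes — it neither pops nor modifies the top frame. -/
def PushMono (ste : Stack) (p : List AState) : Prop :=
  ∀ i, i + 1 < p.length →
    stackOf (p.getD i default) = ste →
    ∃ ext, stackOf (p.getD (i + 1) default) = ext ++ ste

/-! ## Corresponding entries `CE` and `CE*` -/

mutual
  /-- `CE p j i`: the state at position `j` is the corresponding entry of the
  state at position `i` in path `p`. -/
  inductive CE (p : List AState) : ℕ → ℕ → Prop
    | entry (i : ℕ) :
        i < p.length → IsEntry (p.getD i default) → CE p i i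
    | inner (j i : ℕ) :
        i < p.length → 0 < i → ¬ IsEntry (p.getD i default) →
        ¬ IsExitCEval (p.getD (i - 1) default) →
        CE p j (i - 1) → CE p j i
    | callret (j m i : ℕ) :
        i < p.length → 0 < i → ¬ IsEntry (p.getD i default) →
        j < m → m + 3 ≤ i →
        IsCall (p.getD m default) → IsExitCEval (p.getD (i - 1) default) →
        CE p j m → CEstar p (m + 1) (i - 1) → CE p j i

  /-- `CEstar p j i`: the state at position `j` belongs to `CE*` of the state
  at position `i` in path `p`. -/
  inductive CEstar (p : List AState) : ℕ → ℕ → Prop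
    | base (j i : ℕ) : CE p j i → CEstar p j i
    | tail (j m i : ℕ) :
        m + 1 ≤ i → IsTailCall (p.getD m default) →
        IsEntry (p.getD (m + 1) default) → CE p (m + 1) i →
        CEstar p j m → CEstar p j i
end

/-! ## Local semantics (Fig. 7) -/

abbrev LFrame := UVar → Option D

/-- Local states: a single frame of user bindings instead of a stack. -/
inductive LState : Type
  | eval (call : Call) (tf : LFrame) (h : Heap)
  | applyU (f : ULam) (d : D) (h : Heap)
  | applyC (c : CAbs) (d : D) (tf : LFrame) (h : Heap)

instance : Inhabited LState := ⟨.applyC .halt ∅ (fun _ => none) (fun _ => none)⟩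

def topU : Stack → LFrame
  | [] => fun _ => none
  | tf :: _ => tf.u

/-- The map `|·|_al` from abstract to local states. -/
def toLocal : AState → LState
  | .eval call st h => .eval call (topU st) h
  | .applyU f d _ _ h => .applyU f d h
  | .applyC c d st h => .applyC c d (topU st) h

def updL (tf : LFrame) (v : UVar) (d : D) : LFrame :=
  fun x => if x = v then some d else tf x

/-- Local abstract evaluation of user expressions. -/
inductive LEvalU (pr : ULam) : UExp → Lab → LFrame → Heap → D → Prop
  | lam (f : ULam) (ψ : Lab) (tf : LFrame) (h : Heap) :
      LEvalU pr (.lam f) ψ tf h {f}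
  | stk (v : UVar) (ψ : Lab) (tf : LFrame) (h : Heap) (d : D) :
      Sum.inl v ∈ LV pr ψ → tf v = some d → LEvalU pr (.var v) ψ tf h d
  | hp (v : UVar) (ψ : Lab) (tf : LFrame) (h : Heap) (d : D) :
      Sum.inl v ∉ LV pr ψ → h v = some d → LEvalU pr (.var v) ψ tf h d

/-- The local transition relation `≈>` (Fig. 7).  A local `CEval` whose
operator is a variable has no successor. -/
inductive LStep (pr : ULam) : LState → LState → Prop
  | uea :
      LEvalU pr f l tf h df → ulam ∈ df → LEvalU pr e l tf h d →
      LStep pr (.eval (.u l f e q) tf h) (.applyU ulam d h)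
  | uae_h :
      HVar pr u →
      LStep pr (.applyU (.mk l u k body) d h)
               (.eval body (updL (fun _ => none) u d) (hjoin h u d))
  | uae_s :
      ¬ HVar pr u →
      LStep pr (.applyU (.mk l u k body) d h)
               (.eval body (updL (fun _ => none) u d) h)
  | cea :
      LEvalU pr e g tf h d →
      LStep pr (.eval (.c g (.lam cl) e) tf h) (.applyC (.clam cl) d tf h)
  | cae_h :
      HVar pr u →
      LStep pr (.applyC (.clam (.mk g u body)) d tf h)
               (.eval body (updL tf u d) (hjoin h u d))
  | cae_s :
      ¬ HVar pr u →
      LStep pr (.applyC (.clam (.mk g u body)) d tf h)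
               (.eval body (updL tf u d) h)

/-! ### Classification of local states -/

def LIsEntry : LState → Prop
  | .applyU _ _ _ => True
  | _ => False
def LIsCApply : LState → Prop
  | .applyC _ _ _ _ => True
  | _ => False
def LIsInnerCEval : LState → Prop
  | .eval (.c _ (.lam _) _) _ _ => True
  | _ => False
def LIsExitCEval : LState → Prop
  | .eval (.c _ (.var _) _) _ _ => True
  | _ => False
def LIsCall : LState → Prop
  | .eval (.u _ _ _ (.lam _)) _ _ => True
  | _ => False
def LIsTailCall : LState → Prop
  | .eval (.u _ _ _ (.var _)) _ _ => True
  | _ => False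

/-! ## The summarization algorithm (Fig. 8) -/

/-- `UpdateRes pr ς̃1 ς̃2 ς̃3 ς̃4 ς̃`: `ς̃` is the return state computed by
`Update(ς̃1, ς̃2, ς̃3, ς̃4)` (lines 26–33 of Fig. 8): `ς̃1` is an entry, `ς̃2`
a call in the same procedure, `ς̃3` the entry of the callee, `ς̃4` an
Exit-CEval; the return value is the value of the expression passed to the
continuation, and the caller's frame is restored (with stack filtering when
the operator is a stack reference). -/
inductive UpdateRes (pr : ULam) : LState → LState → LState → LState → LState → Prop
  | filter :
      Sum.inl fv ∈ LV pr l2 →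
      LEvalU pr e4 g4 tf4 h4 d →
      UpdateRes pr
        (.applyU (.mk l1 u1 k1 c1) d1 h1)
        (.eval (.u l2 (.var fv) e2 (.lam (.mk g2 u2 c2))) tf2 h2)
        (.applyU (.mk l3 u3 k3 c3) d3 h2)
        (.eval (.c g4 (.var k4) e4) tf4 h4)
        (.applyC (.clam (.mk g2 u2 c2)) d (updL tf2 fv {ULam.mk l3 u3 k3 c3}) h4)
  | heapref :
      Sum.inl fv ∉ LV pr l2 →
      LEvalU pr e4 g4 tf4 h4 d →
      UpdateRes pr
        (.applyU (.mk l1 u1 k1 c1) d1 h1)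
        (.eval (.u l2 (.var fv) e2 (.lam (.mk g2 u2 c2))) tf2 h2)
        (.applyU (.mk l3 u3 k3 c3) d3 h2)
        (.eval (.c g4 (.var k4) e4) tf4 h4)
        (.applyC (.clam (.mk g2 u2 c2)) d tf2 h4)
  | flam :
      LEvalU pr e4 g4 tf4 h4 d →
      UpdateRes pr
        (.applyU (.mk l1 u1 k1 c1) d1 h1)
        (.eval (.u l2 (.lam fl) e2 (.lam (.mk g2 u2 c2))) tf2 h2)
        (.applyU (.mk l3 u3 k3 c3) d3 h2)
        (.eval (.c g4 (.var k4) e4) tf4 h4)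
        (.applyC (.clam (.mk g2 u2 c2)) d tf2 h4)

/-- A configuration of the summarization algorithm. -/
structure Config where
  Seen : Set (LState × LState)
  W : Set (LState × LState)
  Summary : Set (LState × LState)
  Callers : Set (LState × LState × LState)
  TCallers : Set (LState × LState × LState)
  Final : Set LState

/-- `Propagate`: insert a set of edges into `Seen`, and into the workset
unless already seen. -/
def propagate (c : Config) (W0 : Set (LState × LState))
    (P : Set (LState × LState)) : Config :=
  { c with Seen := c.Seen ∪ P, W := W0 ∪ (P \ c.Seen) }

open Classical in
/-- One iteration of the summarization algorithm: process the edge `e`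
removed from the workset (lines 5–24 of Fig. 8). -/
noncomputable def processEdge (pr : ULam) (ι : LState) (c : Config)
    (e : LState × LState) : Config :=
  let W0 := c.W \ {e}
  match e.2 with
  | .applyU _ _ _ =>
      propagate c W0 {q | ∃ s3, LStep pr e.2 s3 ∧ q = (e.1, s3)}
  | .applyC _ _ _ _ =>
      propagate c W0 {q | ∃ s3, LStep pr e.2 s3 ∧ q = (e.1, s3)}
  | .eval (.c _ (.lam _) _) _ _ =>
      propagate c W0 {q | ∃ s3, LStep pr e.2 s3 ∧ q = (e.1, s3)}
  | .eval (.c g (.var _) ex) tf h =>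
      if e.1 = ι then
        { c with
          W := W0,
          Final := c.Final ∪
            {s | ∃ d, LEvalU pr ex g tf h d ∧
                 s = .applyC .halt d (fun _ => none) h} }
      else
        { propagate c W0
            ({q | ∃ s3 s4 r, (s3, s4, e.1) ∈ c.Callers ∧
                  UpdateRes pr s3 s4 e.1 e.2 r ∧ q = (s3, r)} ∪
             {q | ∃ s3 s4, (s3, s4, e.1) ∈ c.TCallers ∧ q = (s3, e.2)})
          with Summary := c.Summary ∪ {e} }
  | .eval (.u _ _ _ (.lam _)) _ _ =>
      { propagate c W0
          ({q | ∃ s3, LStep pr e.2 s3 ∧ q = (s3, s3)} ∪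
           {q | ∃ s3 s4 r, LStep pr e.2 s3 ∧ (s3, s4) ∈ c.Summary ∧
                UpdateRes pr e.1 e.2 s3 s4 r ∧ q = (e.1, r)})
        with Callers := c.Callers ∪ {tr | ∃ s3, LStep pr e.2 s3 ∧ tr = (e.1, e.2, s3)} }
  | .eval (.u _ _ _ (.var _)) _ _ =>
      { propagate c W0
          ({q | ∃ s3, LStep pr e.2 s3 ∧ q = (s3, s3)} ∪
           {q | ∃ s3 s4, LStep pr e.2 s3 ∧ (s3, s4) ∈ c.Summary ∧ q = (e.1, s4)})
        with TCallers := c.TCallers ∪ {tr | ∃ s3, LStep pr e.2 s3 ∧ tr = (e.1, e.2, s3)} }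

/-- One step of the algorithm: pick any edge in the workset and process it. -/
inductive AlgoStep (pr : ULam) (ι : LState) : Config → Config → Prop
  | step (c : Config) (e : LState × LState) :
      e ∈ c.W → AlgoStep pr ι c (processEdge pr ι c e)

/-- The initial configuration (lines 1–2 of Fig. 8). -/
def initConfig (ι : LState) : Config := ⟨{(ι, ι)}, {(ι, ι)}, ∅, ∅, ∅, ∅⟩

/-- The initial abstract state of a program `pr` on input `inp`. -/
def initA (pr inp : ULam) : AState := .applyU pr {inp} .halt [] (fun _ => none)

/-! ## STATEMENT 4: in a push-monotonic path, the stack of the first state is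
a suffix of the stack of every other state -/

/-- A transition alters at most the top frame of the stack: every suffix of the tail survives. -/
theorem AStep.suffix_of_suffix_tail {pr : ULam} {s s' : AState} (h : AStep pr s s')
    {ste st : Stack} {tf : Frame} (hs : stackOf s = tf :: st) (hsuf : ste <:+ st) :
    ste <:+ stackOf s' := by
  cases h <;> simp only [stackOf, List.cons.injEq] at hs ⊢ <;>
    first
    | (obtain ⟨rfl, rfl⟩ := hs
       first
       | exact hsuf
       | exact hsuf.trans (List.suffix_cons _ _))
    | (subst hs
       first
       | exact hsuf.trans (List.suffix_cons _ _)
       | exact (hsuf.trans (List.suffix_cons _ _)).trans (List.suffix_cons _ _))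

/-- Push monotonicity of a path is inherited by its tail. -/
theorem PushMono.tail {ste : Stack} {s : AState} {p : List AState}
    (h : PushMono ste (s :: p)) : PushMono ste p := fun i hi heq =>
  h (i + 1) (by simpa using hi) (by simpa using heq)

/-- A stack that is a suffix of the first stack of a push-monotonic path is a suffix of
every stack in the path. -/
theorem PushMono.suffix_of_mem {pr : ULam} {ste : Stack} {p : List AState} {s : AState}
    (hs : ste <:+ stackOf s) (hchain : List.IsChain (AStep pr) (s :: p))
    (hpm : PushMono ste (s :: p)) : ∀ x ∈ s :: p, ste <:+ stackOf x := by
  induction p generalizing s with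
  | nil => simpa using hs
  | cons a p ih =>
    rw [List.isChain_cons_cons] at hchain
    refine List.forall_mem_cons.2 ⟨hs, ih ?_ hchain.2 hpm.tail⟩
    by_cases heq : stackOf s = ste
    · obtain ⟨ext, hext⟩ := hpm 0 (by simp) (by simpa using heq)
      exact ⟨ext, by simpa using hext.symm⟩
    · cases hstk : stackOf s with
      | nil => exact absurd (by rw [hstk] at hs ⊢; exact (List.suffix_nil.1 hs).symm) heq
      | cons tf st =>
        rw [hstk] at hs heq
        exact hchain.1.suffix_of_suffix_tail hstk
          ((List.suffix_cons_iff.1 hs).resolve_left fun h => heq h.symm)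

theorem pushMono_stack_suffix (pr : ULam) (se : AState) (rest : List AState)
    (ste : Stack)
    (hentry : IsEntry se) (hst : stackOf se = ste)
    (hchain : (se :: rest).Chain' (AStep pr))
    (hpm : PushMono ste (se :: rest)) :
    ∀ s ∈ se :: rest, ste <:+ stackOf s := by
  exact PushMono.suffix_of_mem (hst ▸ List.suffix_rfl) hchain hpm

end CFA2
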